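/- If C ∈ ℝ, τ in the upper half-plane, f_C(τ) = 0 and g₂(τ) ≠ 0, then f_C'(τ) = −7g₂(τ)(g₂(τ)³ − 27g₃(τ)²)/(g₂(τ)² − 18η₁(τ)g₃(τ)); in particular f_C'(τ) ≠ 0. -/

import Mathlib

open Complex Filter Asymptotics Set

noncomputable section

/-- q = e^{2πiτ} -/
def qq (τ : ℂ) : ℂ := Complex.exp (2 * (Real.pi : ℂ) * Complex.I * τ)

/-- divisor power sum σ_k(n) as a complex number -/
def sigmaC (k n : ℕ) : ℂ := ∑ d ∈ n.divisors, (d : ℂ) ^ k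

/-- normalized Eisenstein series E₂ -/
def E2 (τ : ℂ) : ℂ := 1 - 24 * ∑' n : ℕ, sigmaC 1 (n + 1) * qq τ ^ (n + 1)

/-- normalized Eisenstein series E₄ -/
def E4 (τ : ℂ) : ℂ := 1 + 240 * ∑' n : ℕ, sigmaC 3 (n + 1) * qq τ ^ (n + 1)

/-- normalized Eisenstein series E₆ -/
def E6 (τ : ℂ) : ℂ := 1 - 504 * ∑' n : ℕ, sigmaC 5 (n + 1) * qq τ ^ (n + 1)

/-- elliptic invariant g₂ -/
def g2 (τ : ℂ) : ℂ := (4 * (Real.pi : ℂ) ^ 4 / 3) * E4 τ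

/-- elliptic invariant g₃ -/
def g3 (τ : ℂ) : ℂ := (8 * (Real.pi : ℂ) ^ 6 / 27) * E6 τ

/-- quasi-period η₁ -/
def eta1 (τ : ℂ) : ℂ := ((Real.pi : ℂ) ^ 2 / 3) * E2 τ

/-- quasi-period η₂ (Legendre relation) -/
def eta2 (τ : ℂ) : ℂ := τ * eta1 τ - 2 * (Real.pi : ℂ) * Complex.I

/-- the function h = g₂² − 18η₁g₃ -/
def hh (τ : ℂ) : ℂ := g2 τ ^ 2 - 18 * eta1 τ * g3 τ

/-- the family f_C -/
def f (C τ : ℂ) : ℂ := (C - τ) * g2 τ ^ 2 - 18 * (C * eta1 τ - eta2 τ) * g3 τ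

end


open scoped Manifold MatrixGroups ModularForm Topology ArithmeticFunction.sigma
open UpperHalfPlane (atImInfty ofComplex)

noncomputable section

/-- The generating series of `σ_k`, as a function of `q`. -/
def sigmaSeries (k : ℕ) (q : ℂ) : ℂ := ∑' n : ℕ, sigmaC k (n + 1) * q ^ (n + 1)

lemma sigmaC_eq (k n : ℕ) : sigmaC k n = (ArithmeticFunction.sigma k n : ℂ) := by
  simp [sigmaC, ArithmeticFunction.sigma_apply]

lemma sigmaSeries_differentiableOn (k : ℕ) :
    DifferentiableOn ℂ (sigmaSeries k) (Metric.ball 0 1) := by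
  intro q hq
  have hq1 : ‖q‖ < 1 := by simpa using hq
  obtain ⟨r, hr0, hr1⟩ := exists_between hq1
  have hrpos : 0 < r := (norm_nonneg q).trans_lt hr0
  have hsum : Summable fun n : ℕ => ((n + 1 : ℕ) : ℝ) ^ (k + 1) * r ^ (n + 1) := by
    have h := summable_pow_mul_geometric_of_norm_lt_one (R := ℝ) (k + 1) (r := r)
      (by rwa [Real.norm_of_nonneg hrpos.le])
    exact (summable_nat_add_iff 1).mpr h
  have hd : DifferentiableOn ℂ (sigmaSeries k) (Metric.ball 0 r) := by
    refine Complex.differentiableOn_tsum_of_summable_norm hsum (fun n => by fun_prop) Metric.isOpen_ball ?_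
    intro n w hw
    have hw' : ‖w‖ ≤ r := by simpa using (le_of_lt (by simpa using hw))
    rw [sigmaC_eq, norm_mul, norm_pow, Complex.norm_natCast]
    gcongr
    exact_mod_cast ArithmeticFunction.sigma_le_pow_succ k (n + 1)
  exact (hd.differentiableAt (Metric.isOpen_ball.mem_nhds (by simpa using hr0))).differentiableWithinAt

lemma sigmaSeries_zero (k : ℕ) : sigmaSeries k 0 = 0 := by simp [sigmaSeries]

lemma E2_eq_series (τ : ℂ) : E2 τ = 1 + (-24) * sigmaSeries 1 (qq τ) := by
  simp [E2, sigmaSeries]; ring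
lemma E4_eq_series (τ : ℂ) : E4 τ = 1 + 240 * sigmaSeries 3 (qq τ) := rfl
lemma E6_eq_series (τ : ℂ) : E6 τ = 1 + (-504) * sigmaSeries 5 (qq τ) := by
  simp [E6, sigmaSeries]; ring

lemma qq_eq_qParam (τ : ℂ) : qq τ = Function.Periodic.qParam 1 τ := by
  simp [qq, Function.Periodic.qParam]

lemma norm_qq_lt_one {τ : ℂ} (h : 0 < τ.im) : ‖qq τ‖ < 1 :=
  UpperHalfPlane.norm_exp_two_pi_I_lt_one ⟨τ, h⟩

lemma hasDerivAt_qq (τ : ℂ) : HasDerivAt qq (2 * Real.pi * I * qq τ) τ := by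
  have h : HasDerivAt (fun τ : ℂ => 2 * (Real.pi : ℂ) * I * τ) (2 * (Real.pi : ℂ) * I) τ := by
    simpa using (hasDerivAt_id τ).const_mul (2 * (Real.pi : ℂ) * I)
  have h2 := h.cexp
  rw [mul_comm (cexp _)] at h2
  exact h2

lemma hasDerivAt_series (k : ℕ) (c τ : ℂ) (h : 0 < τ.im) :
    HasDerivAt (fun τ => 1 + c * sigmaSeries k (qq τ))
      (c * (deriv (sigmaSeries k) (qq τ) * (2 * Real.pi * I * qq τ))) τ := by
  have hm : qq τ ∈ Metric.ball (0 : ℂ) 1 := by simpa using norm_qq_lt_one h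
  have h1 := ((sigmaSeries_differentiableOn k).differentiableAt
    (Metric.isOpen_ball.mem_nhds hm)).hasDerivAt
  exact ((h1.comp τ (hasDerivAt_qq τ)).const_mul c).const_add 1

lemma tendsto_qq : Tendsto (fun z : UpperHalfPlane => qq z) atImInfty (𝓝 0) := by
  simpa [qq_eq_qParam] using UpperHalfPlane.qParam_tendsto_atImInfty one_pos

lemma tendsto_series (k : ℕ) (c : ℂ) :
    Tendsto (fun z : UpperHalfPlane => 1 + c * sigmaSeries k (qq z)) atImInfty (𝓝 1) := by
  have hc : ContinuousAt (sigmaSeries k) 0 := ((sigmaSeries_differentiableOn k).differentiableAt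
    (Metric.isOpen_ball.mem_nhds (by simp))).continuousAt
  have := ((hc.tendsto.comp tendsto_qq).const_mul c).const_add 1
  simpa [sigmaSeries_zero] using! this

lemma tendsto_deriv_series (k : ℕ) (c : ℂ) :
    Tendsto (fun z : UpperHalfPlane => deriv (fun τ => 1 + c * sigmaSeries k (qq τ)) (z : ℂ))
      atImInfty (𝓝 0) := by
  have hc : ContinuousAt (deriv (sigmaSeries k)) 0 :=
    (((sigmaSeries_differentiableOn k).deriv Metric.isOpen_ball).differentiableAt
    (Metric.isOpen_ball.mem_nhds (by simp))).continuousAt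
  have := ((hc.tendsto.comp tendsto_qq).mul (tendsto_qq.const_mul (2 * Real.pi * I))).const_mul c
  simp only [mul_zero] at this
  refine this.congr fun z => ?_
  exact (hasDerivAt_series k c z z.im_pos).deriv.symm

lemma series_pnat (k : ℕ) (z : ℂ) :
    ∑' n : ℕ+, (ArithmeticFunction.sigma k n : ℂ) * cexp (2 * Real.pi * I * z) ^ (n : ℕ)
      = sigmaSeries k (qq z) := by
  rw [tsum_pnat_eq_tsum_succ
    (f := fun n => (ArithmeticFunction.sigma k n : ℂ) * cexp (2 * Real.pi * I * z) ^ n)]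
  simp [sigmaSeries, sigmaC_eq, qq]

lemma mE2_eq (z : UpperHalfPlane) : EisensteinSeries.E2 z = E2 z := by
  rw [EisensteinSeries.E2_eq_tsum_cexp, series_pnat, E2_eq_series]; ring

lemma mE4_eq (z : UpperHalfPlane) : ModularForm.E₄ z = E4 z := by
  have h := EisensteinSeries.q_expansion_bernoulli (k := 4) (by norm_num) ⟨2, rfl⟩ z
  simp only [zpow_natCast] at h
  rw [h, series_pnat, E4_eq_series]
  norm_num [show bernoulli 4 = -1 / 30 by decide +kernel]

lemma mE6_eq (z : UpperHalfPlane) : ModularForm.E₆ z = E6 z := by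
  have h := EisensteinSeries.q_expansion_bernoulli (k := 6) (by norm_num) ⟨3, rfl⟩ z
  simp only [zpow_natCast] at h
  rw [h, series_pnat, E6_eq_series]
  norm_num [show bernoulli 6 = 1 / 42 by decide +kernel]
  ring

lemma disc_ne (τ : ℂ) (h : 0 < τ.im) : E4 τ ^ 3 - E6 τ ^ 2 ≠ 0 := by
  have h1 := ModularForm.discriminant_eq_E₄_cube_sub_E₆_sq ⟨τ, h⟩
  have h2 := ModularForm.discriminant_ne_zero ⟨τ, h⟩
  rw [h1, mE4_eq, mE6_eq] at h2
  intro h0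
  exact h2 (by simp [h0])

/-- Invariant holomorphic functions of weight < 12 vanishing at infinity are zero. -/
lemma eq_zero_of_inv {k : ℤ} (hk : k < 12) (F : UpperHalfPlane → ℂ) (hF : MDiff F)
    (hinv : ∀ γ : SL(2, ℤ), F ∣[k] γ = F) (hz : Tendsto F atImInfty (𝓝 0)) : F = 0 := by
  let G : CuspForm 𝒮ℒ k :=
    { toFun := F
      slash_action_eq' := fun A hA => by
        obtain ⟨A, rfl⟩ := hA
        exact hinv A
      holo' := hF
      zero_at_cusps' := fun hc => by
        rw [Subgroup.IsArithmetic.isCusp_iff_isCusp_SL2Z] at hc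
        rw [OnePoint.isZeroAt_iff_forall_SL2Z hc]
        intro γ _
        rw [hinv γ]
        exact hz }
  have : G = 0 := rank_zero_iff_forall_zero.mp (CuspForm.rank_eq_zero_of_weight_lt_twelve hk) G
  exact congrArg DFunLike.coe this

end

noncomputable section
open Derivative

lemma D_eq {F : UpperHalfPlane → ℂ} {G : ℂ → ℂ} (h : ∀ z : UpperHalfPlane, F z = G z)
    (z : UpperHalfPlane) :
    normalizedDerivOfComplex F z = (2 * Real.pi * I)⁻¹ * deriv G z := by
  unfold normalizedDerivOfComplex
  congr 1
  apply Filter.EventuallyEq.deriv_eq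
  filter_upwards [UpperHalfPlane.isOpen_upperHalfPlaneSet.mem_nhds z.im_pos] with w hw
  simp [UpperHalfPlane.ofComplex_apply_of_im_pos hw, h]

lemma E4_fun : E4 = fun τ => 1 + 240 * sigmaSeries 3 (qq τ) := funext E4_eq_series
lemma E2_fun : E2 = fun τ => 1 + (-24) * sigmaSeries 1 (qq τ) := funext E2_eq_series
lemma E6_fun : E6 = fun τ => 1 + (-504) * sigmaSeries 5 (qq τ) := funext E6_eq_series

lemma tendsto_D {F : UpperHalfPlane → ℂ} {G : ℂ → ℂ} (h : ∀ z : UpperHalfPlane, F z = G z)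
    (k : ℕ) (c : ℂ) (hG : G = fun τ => 1 + c * sigmaSeries k (qq τ)) :
    Tendsto (normalizedDerivOfComplex F) atImInfty (𝓝 0) := by
  have := (tendsto_deriv_series k c).const_mul (2 * Real.pi * I)⁻¹
  rw [mul_zero] at this
  refine this.congr fun z => ?_
  rw [D_eq h, hG]

lemma tendsto_F {F : UpperHalfPlane → ℂ} {G : ℂ → ℂ} (h : ∀ z : UpperHalfPlane, F z = G z)
    (k : ℕ) (c : ℂ) (hG : G = fun τ => 1 + c * sigmaSeries k (qq τ)) :
    Tendsto F atImInfty (𝓝 1) := by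
  refine (tendsto_series k c).congr fun z => ?_
  rw [h, hG]

lemma tE2 : Tendsto EisensteinSeries.E2 atImInfty (𝓝 1) := tendsto_F mE2_eq _ _ E2_fun
lemma tE4 : Tendsto ModularForm.E₄ atImInfty (𝓝 1) := tendsto_F mE4_eq _ _ E4_fun
lemma tE6 : Tendsto ModularForm.E₆ atImInfty (𝓝 1) := tendsto_F mE6_eq _ _ E6_fun

lemma inv_of_form {k : ℤ} (F : ModularForm 𝒮ℒ k) (γ : SL(2, ℤ)) : (F : UpperHalfPlane → ℂ) ∣[k] γ = F :=
  F.slash_action_eq' _ ⟨γ, rfl⟩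

lemma ramanujan4 (z : UpperHalfPlane) :
    normalizedDerivOfComplex ModularForm.E₄ z
      = (EisensteinSeries.E2 z * ModularForm.E₄ z - ModularForm.E₆ z) / 3 := by
  have h := eq_zero_of_inv (k := 6) (by norm_num)
    (serreDerivative (4 : ℤ) ModularForm.E₄ + (1 / 3 : ℂ) • ⇑ModularForm.E₆)
    ((serreDerivative_mdifferentiable _ ModularForm.E₄.holo').add
      (ModularForm.E₆.holo'.const_smul _)) ?_ ?_
  · have := congrFun h z
    simp at this
    linear_combination this
  · intro γ
    have h1 := serreDerivative_slash_invariant (k := 4) ModularForm.E₄.holo' (inv_of_form ModularForm.E₄ γ)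
    rw [SlashAction.add_slash, ModularForm.SL_smul_slash, inv_of_form ModularForm.E₆ γ]
    exact congrArg (· + _) h1
  · have := ((tendsto_D mE4_eq _ _ E4_fun).sub ((tE2.mul tE4).const_mul (1/3 : ℂ))).add
      (tE6.const_mul (1/3 : ℂ))
    norm_num at this
    refine this.congr fun z => ?_
    simp
    ring

lemma ramanujan6 (z : UpperHalfPlane) :
    normalizedDerivOfComplex ModularForm.E₆ z
      = (EisensteinSeries.E2 z * ModularForm.E₆ z - ModularForm.E₄ z ^ 2) / 2 := by
  have h := eq_zero_of_inv (k := 8) (by norm_num)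
    (serreDerivative (6 : ℤ) ModularForm.E₆ + (1 / 2 : ℂ) • (⇑ModularForm.E₄ * ⇑ModularForm.E₄))
    ((serreDerivative_mdifferentiable _ ModularForm.E₆.holo').add
      ((ModularForm.E₄.holo'.mul ModularForm.E₄.holo').const_smul _)) ?_ ?_
  · have := congrFun h z
    simp at this
    linear_combination this
  · intro γ
    have h1 := serreDerivative_slash_invariant (k := 6) ModularForm.E₆.holo' (inv_of_form ModularForm.E₆ γ)
    have h2 := ModularForm.mul_slash_SL2 4 4 γ ModularForm.E₄ ModularForm.E₄
    rw [inv_of_form ModularForm.E₄ γ] at h2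
    rw [SlashAction.add_slash, ModularForm.SL_smul_slash]
    exact congrArg₂ (· + (1 / 2 : ℂ) • ·) h1 h2
  · have := ((tendsto_D mE6_eq _ _ E6_fun).sub ((tE2.mul tE6).const_mul (1/2 : ℂ))).add
      ((tE4.mul tE4).const_mul (1/2 : ℂ))
    norm_num at this
    refine this.congr fun z => ?_
    simp
    ring

lemma D_D2 (γ : SL(2, ℤ)) (z : UpperHalfPlane) :
    normalizedDerivOfComplex (EisensteinSeries.D2 γ) z
      = - ((γ 1 0 : ℂ) / UpperHalfPlane.denom γ z) ^ 2 := by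
  have hne : UpperHalfPlane.denom γ z ≠ 0 := UpperHalfPlane.denom_ne_zero _ z
  have hd := (UpperHalfPlane.hasDerivAt_denom_zpow (γ : GL (Fin 2) ℝ) (-1) z).const_mul
    (2 * (Real.pi : ℂ) * I * γ 1 0)
  rw [D_eq (G := fun w => (2 * (Real.pi : ℂ) * I * γ 1 0) *
    (UpperHalfPlane.denom (γ : GL (Fin 2) ℝ) w) ^ (-1 : ℤ)), hd.deriv]
  · have hpi : (Real.pi : ℂ) ≠ 0 := by exact_mod_cast Real.pi_ne_zero
    have hz : UpperHalfPlane.denom (γ : GL (Fin 2) ℝ) z ^ (-1 - 1 : ℤ)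
      = (UpperHalfPlane.denom γ z ^ 2)⁻¹ := by norm_num [zpow_neg]
    rw [hz]
    simp
    field_simp
    rw [I_sq]; ring
  · intro w
    simp [EisensteinSeries.D2, div_eq_mul_inv]

lemma ramanujan2 (z : UpperHalfPlane) :
    normalizedDerivOfComplex EisensteinSeries.E2 z
      = (EisensteinSeries.E2 z ^ 2 - ModularForm.E₄ z) / 12 := by
  have hE := E2_mdifferentiable
  have h := eq_zero_of_inv (k := 4) (by norm_num)
    (normalizedDerivOfComplex EisensteinSeries.E2
      + (-1 / 12 : ℂ) • (EisensteinSeries.E2 * EisensteinSeries.E2)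
      + (1 / 12 : ℂ) • ⇑ModularForm.E₄)
    (((normalizedDerivOfComplex_mdifferentiable hE).add
      ((hE.mul hE).const_smul _)).add (ModularForm.E₄.holo'.const_smul _)) ?_ ?_
  · have := congrFun h z
    simp at this
    linear_combination this
  · intro γ
    have h2 := ModularForm.mul_slash_SL2 2 2 γ EisensteinSeries.E2 EisensteinSeries.E2
    have h3 := normalizedDerivOfComplex_SL_slash (k := 2) hE (γ := γ)
    have h4 := EisensteinSeries.E2_slash_action γ
    have hD2 : MDiff (EisensteinSeries.D2 γ) := by
      have : EisensteinSeries.D2 γ = (2 * riemannZeta 2) •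
          (EisensteinSeries.E2 - EisensteinSeries.E2 ∣[(2 : ℤ)] γ) := by
        rw [h4]; ext w; simp [riemannZeta_two]
        have hpi : (Real.pi : ℂ) ≠ 0 := by exact_mod_cast Real.pi_ne_zero
        field_simp
      rw [this]
      exact (hE.sub (hE.slash 2 _)).const_smul _
    rw [SlashAction.add_slash, SlashAction.add_slash, ModularForm.SL_smul_slash,
      ModularForm.SL_smul_slash, inv_of_form ModularForm.E₄ γ]
    congr 1
    ext w
    rw [h4, normalizedDerivOfComplex_sub _ _ hE (hD2.const_smul _),
      normalizedDerivOfComplex_smul _ _ hD2] at h3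
    have h3w := congrFun h3 w
    have h2w := congrFun h2 w
    rw [h4] at h2w
    norm_num only at h2w h3w
    simp only [Pi.add_apply, Pi.sub_apply, Pi.smul_apply, Pi.mul_apply, smul_eq_mul, D_D2, riemannZeta_two] at h2w h3w ⊢
    have hpi : (Real.pi : ℂ) ≠ 0 := by exact_mod_cast Real.pi_ne_zero
    have hD : EisensteinSeries.D2 γ w
        = 2 * Real.pi * I * ((γ 1 0 : ℂ) / UpperHalfPlane.denom γ w) := by
      simp only [EisensteinSeries.D2]; ring
    rw [hD] at h2w h3w
    generalize (γ 1 0 : ℂ) / UpperHalfPlane.denom γ w = u at h2w h3w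
    have hpI : (2 * (Real.pi : ℂ) * I)⁻¹ = - I / (2 * Real.pi) := by
      rw [inv_eq_iff_eq_inv, inv_div]; field_simp; simp
    rw [hpI] at h3w
    have e1 : (1 / (2 * ((Real.pi : ℂ) ^ 2 / 6))) = 3 / Real.pi ^ 2 := by field_simp; norm_num
    rw [e1] at h2w h3w
    have e2 : 3 / (Real.pi : ℂ) ^ 2 * (2 * Real.pi * I * u) = 6 * I * u * (Real.pi : ℂ)⁻¹ := by
      field_simp; ring
    rw [e2] at h2w h3w
    linear_combination -h3w - (1 / 12) * h2w + (3 * u ^ 2 * (Real.pi : ℂ)⁻¹ ^ 2) * I_sq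
  · have := ((tendsto_D mE2_eq _ _ E2_fun).add ((tE2.mul tE2).const_mul (-1/12 : ℂ))).add
      (tE4.const_mul (1/12 : ℂ))
    norm_num at this
    refine this.congr fun z => ?_
    simp
    ring

end

section
lemma hasDerivAt_E {F : UpperHalfPlane → ℂ} {G : ℂ → ℂ} (h : ∀ z : UpperHalfPlane, F z = G z)
    {k : ℕ} {c : ℂ} (hG : G = fun τ => 1 + c * sigmaSeries k (qq τ)) (τ : ℂ) (hτ : 0 < τ.im)
    {r : ℂ} (hr : Derivative.normalizedDerivOfComplex F ⟨τ, hτ⟩ = r) :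
    HasDerivAt G (2 * Real.pi * I * r) τ := by
  have hd : DifferentiableAt ℂ G τ := by
    rw [hG]; exact (hasDerivAt_series k c τ hτ).differentiableAt
  rw [D_eq h] at hr
  have hpi : (Real.pi : ℂ) ≠ 0 := by exact_mod_cast Real.pi_ne_zero
  have : 2 * Real.pi * I * r = deriv G τ := by
    rw [← hr, mul_inv_cancel_left₀ Complex.two_pi_I_ne_zero]
  rw [this]; exact hd.hasDerivAt

lemma hasDerivAt_E2 (τ : ℂ) (hτ : 0 < τ.im) :
    HasDerivAt E2 (2 * Real.pi * I * ((E2 τ ^ 2 - E4 τ) / 12)) τ := by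
  have := hasDerivAt_E mE2_eq E2_fun τ hτ (ramanujan2 ⟨τ, hτ⟩)
  rwa [mE2_eq, mE4_eq] at this

lemma hasDerivAt_E4 (τ : ℂ) (hτ : 0 < τ.im) :
    HasDerivAt E4 (2 * Real.pi * I * ((E2 τ * E4 τ - E6 τ) / 3)) τ := by
  have := hasDerivAt_E mE4_eq E4_fun τ hτ (ramanujan4 ⟨τ, hτ⟩)
  rwa [mE2_eq, mE4_eq, mE6_eq] at this

lemma hasDerivAt_E6 (τ : ℂ) (hτ : 0 < τ.im) :
    HasDerivAt E6 (2 * Real.pi * I * ((E2 τ * E6 τ - E4 τ ^ 2) / 2)) τ := by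
  have := hasDerivAt_E mE6_eq E6_fun τ hτ (ramanujan6 ⟨τ, hτ⟩)
  rwa [mE2_eq, mE4_eq, mE6_eq] at this

lemma hasDerivAt_eta1 (τ : ℂ) (hτ : 0 < τ.im) :
    HasDerivAt eta1 (I / (24 * Real.pi) * (12 * eta1 τ ^ 2 - g2 τ)) τ := by
  have hpi : (Real.pi : ℂ) ≠ 0 := by exact_mod_cast Real.pi_ne_zero
  refine ((hasDerivAt_E2 τ hτ).const_mul ((Real.pi : ℂ) ^ 2 / 3) : HasDerivAt eta1 _ τ).congr_deriv ?_
  simp only [eta1, g2]; field_simp; ring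

lemma hasDerivAt_g2 (τ : ℂ) (hτ : 0 < τ.im) :
    HasDerivAt g2 (I / Real.pi * (2 * eta1 τ * g2 τ - 3 * g3 τ)) τ := by
  have hpi : (Real.pi : ℂ) ≠ 0 := by exact_mod_cast Real.pi_ne_zero
  refine ((hasDerivAt_E4 τ hτ).const_mul (4 * (Real.pi : ℂ) ^ 4 / 3) : HasDerivAt g2 _ τ).congr_deriv ?_
  simp only [eta1, g2, g3]; field_simp; ring

lemma hasDerivAt_g3 (τ : ℂ) (hτ : 0 < τ.im) :
    HasDerivAt g3 (-I / (6 * Real.pi) * (g2 τ ^ 2 - 18 * eta1 τ * g3 τ)) τ := by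
  have hpi : (Real.pi : ℂ) ≠ 0 := by exact_mod_cast Real.pi_ne_zero
  refine ((hasDerivAt_E6 τ hτ).const_mul (8 * (Real.pi : ℂ) ^ 6 / 27) : HasDerivAt g3 _ τ).congr_deriv ?_
  simp only [eta1, g2, g3]; field_simp; ring

lemma f_eq (C : ℂ) : f C = fun τ => (C - τ) * (g2 τ ^ 2 - 18 * (eta1 τ * g3 τ))
    - 36 * Real.pi * I * g3 τ := by
  funext τ; simp only [f, eta2]; ring

end

theorem f_C_deriv_at_zero (C : ℝ) (τ : ℂ) (hτ : 0 < τ.im)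
    (hf : f (C : ℂ) τ = 0) (hg2 : g2 τ ≠ 0) :
    deriv (f (C : ℂ)) τ =
      -7 * g2 τ * (g2 τ ^ 3 - 27 * g3 τ ^ 2) / (g2 τ ^ 2 - 18 * eta1 τ * g3 τ) ∧
    deriv (f (C : ℂ)) τ ≠ 0 := by
  have hpi : (Real.pi : ℂ) ≠ 0 := by exact_mod_cast Real.pi_ne_zero
  have hdisc : g2 τ ^ 3 - 27 * g3 τ ^ 2 ≠ 0 := by
    have : g2 τ ^ 3 - 27 * g3 τ ^ 2
        = (64 * (Real.pi : ℂ) ^ 12 / 27) * (E4 τ ^ 3 - E6 τ ^ 2) := by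
      simp only [g2, g3]; ring
    rw [this]
    exact mul_ne_zero (by simp [hpi]) (disc_ne τ hτ)
  have h1 := hasDerivAt_eta1 τ hτ
  have h2 := hasDerivAt_g2 τ hτ
  have h3 := hasDerivAt_g3 τ hτ
  have hd := ((((hasDerivAt_id τ).const_sub (C : ℂ)).mul
    ((h2.pow 2).sub ((h1.mul h3).const_mul 18))).sub (h3.const_mul (36 * Real.pi * I)))
  have e1 : 36 * Real.pi * I * (-I / (6 * Real.pi) * (g2 τ ^ 2 - 18 * eta1 τ * g3 τ))
      = 6 * (g2 τ ^ 2 - 18 * eta1 τ * g3 τ) := by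
    field_simp; rw [I_sq]; ring
  have hd' : deriv (f (C : ℂ)) τ = -7 * (g2 τ ^ 2 - 18 * eta1 τ * g3 τ)
      + (C - τ) * (I * (Real.pi : ℂ)⁻¹ * (2 * g2 τ * (2 * eta1 τ * g2 τ - 3 * g3 τ)
        - 18 * ((12 * eta1 τ ^ 2 - g2 τ) * g3 τ / 24
          - eta1 τ * (g2 τ ^ 2 - 18 * eta1 τ * g3 τ) / 6))) := by
    rw [e1] at hd
    rw [f_eq]
    refine hd.deriv.trans ?_
    simp only [id, Pi.mul_apply, Pi.sub_apply, Pi.pow_apply]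
    push_cast
    ring
  have hf' := hf
  rw [f_eq] at hf'
  simp only at hf'
  have hne : g2 τ ^ 2 - 18 * eta1 τ * g3 τ ≠ 0 := by
    intro h0
    have : 36 * Real.pi * I * g3 τ = 0 := by
      linear_combination ((C : ℂ) - τ) * h0 - hf'
    have hg3 : g3 τ = 0 := by simpa [hpi] using this
    rw [hg3] at h0
    apply hg2
    simpa using h0
  have key : deriv (f (C : ℂ)) τ =
      -7 * g2 τ * (g2 τ ^ 3 - 27 * g3 τ ^ 2) / (g2 τ ^ 2 - 18 * eta1 τ * g3 τ) := by
    rw [eq_div_iff hne, hd']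
    have e2 : I * (Real.pi : ℂ)⁻¹ * (36 * Real.pi * I * g3 τ) = -36 * g3 τ := by
      field_simp; rw [I_sq]; ring
    linear_combination (2 * g2 τ * (2 * eta1 τ * g2 τ - 3 * g3 τ)
        - 18 * ((12 * eta1 τ ^ 2 - g2 τ) * g3 τ / 24
          - eta1 τ * (g2 τ ^ 2 - 18 * eta1 τ * g3 τ) / 6)) *
        (I * (Real.pi : ℂ)⁻¹ * hf' + e2)
  refine ⟨key, ?_⟩
  rw [key]
  exact div_ne_zero (mul_ne_zero (mul_ne_zero (by norm_num) hg2) hdisc) hne
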